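/- Let B ⊂ ℝⁿ be a ball and g ∈ L¹(B) nonnegative. Suppose there exist c ≥ 1, d ∈ (0,1) and a nonnegative function U ∈ L^{1+δ₀}(B) for some δ₀ > 0, such that for all concentric balls B_ρ ⊂ B_{2ρ} ⊂ B: ⨍_{B_ρ} g dx ≤ c (⨍_{B_{2ρ}} g^d dx)^{1/d} + c ⨍_{B_{2ρ}} U dx. Then there exist δ ∈ (0, δ₀] and c' ≥ 1, depending only on n, c, d, δ₀, such that g ∈ L^{1+δ}_{loc}(B) and (⨍_{B_ρ} g^{1+δ} dx)^{1/(1+δ)} ≤ c' ⨍_{B_{2ρ}} g dx + c' (⨍_{B_{2ρ}} U^{1+δ} dx)^{1/(1+δ)} for all such balls. -/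

import Mathlib

open MeasureTheory
open scoped ENNReal

lemma gh_absorb {a b h : ℝ≥0∞} (ha : a ≠ ∞) (h2 : h * 2 ≤ a) (hab : a ≤ b + h) : a ≤ 2 * b := by
  by_cases hb : b = ∞
  · simp [hb]
  have hh : h ≠ ∞ := by
    intro hh; rw [hh] at h2; simp at h2; exact ha h2
  lift a to NNReal using ha
  lift b to NNReal using hb
  lift h to NNReal using hh
  norm_cast at *
  have e1 : (h:ℝ) * 2 ≤ a := by exact_mod_cast h2
  have e2 : (a:ℝ) ≤ b + h := by exact_mod_cast hab
  have : (a:ℝ) ≤ 2 * b := by linarith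
  exact_mod_cast this

lemma gh_layer {α : Type*} [MeasurableSpace α] (μ : Measure α) {H W : α → ℝ≥0∞}
    (hH : Measurable H) (hW : Measurable W) (hfin : ∀ x, H x ≠ ∞) {p : ℝ} (hp : 0 < p) :
    ∫⁻ x, W x * H x ^ p ∂μ = ENNReal.ofReal p *
      ∫⁻ t in Set.Ioi (0:ℝ), (∫⁻ x in {x | ENNReal.ofReal t < H x}, W x ∂μ) *
        ENNReal.ofReal (t ^ (p - 1)) := by
  have h := lintegral_rpow_eq_lintegral_meas_lt_mul (μ.withDensity W) (f := fun x => (H x).toReal)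
    (Filter.Eventually.of_forall fun x => ENNReal.toReal_nonneg) hH.ennreal_toReal.aemeasurable hp
  have e1 : ∀ x, ENNReal.ofReal ((H x).toReal ^ p) = H x ^ p := by
    intro x
    rw [← ENNReal.ofReal_rpow_of_nonneg ENNReal.toReal_nonneg hp.le, ENNReal.ofReal_toReal (hfin x)]
  simp only [e1] at h
  rw [lintegral_withDensity_eq_lintegral_mul _ hW (hH.pow_const p)] at h
  simp only [Pi.mul_apply] at h
  rw [h]
  congr 1
  apply setLIntegral_congr_fun measurableSet_Ioi
  intro t ht
  simp only
  congr 1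
  have : {a | t < (H a).toReal} = {x | ENNReal.ofReal t < H x} := by
    ext x
    simp only [Set.mem_ofPred_eq]
    rw [ENNReal.ofReal_lt_iff_lt_toReal (le_of_lt ht) (hfin x)]
  rw [this, withDensity_apply]
  exact measurableSet_lt measurable_const hH

lemma gh_perball {α : Type*} [MeasurableSpace α] (ν : Measure α) [IsFiniteMeasure ν]
    (hν : ν Set.univ ≠ 0) {F V : α → ℝ≥0∞} (hF : Measurable F) (hV : Measurable V)
    {T e C : ℝ≥0∞} {d : ℝ} (hd0 : 0 < d) (hd1 : d < 1) (hT0 : T ≠ 0) (hT : T ≠ ∞)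
    (hC1 : 1 ≤ C) (he : e ≤ 1) (hed : e ^ d * (4 * C) ≤ 1)
    (h : T ≤ C * (((∫⁻ x, F x ^ d ∂ν) / ν Set.univ) ^ (1 / d) +
      (∫⁻ x, V x ∂ν) / ν Set.univ)) :
    T * ν Set.univ ≤ 4 * C * (T ^ (1 - d) * ∫⁻ x in {x | e * T < F x}, F x ^ d ∂ν) +
      4 * C * ∫⁻ x in {x | e * T < V x}, V x ∂ν := by
  set M := ν Set.univ with hM
  have hMt : M ≠ ∞ := measure_ne_top _ _
  set J := ∫⁻ x, F x ^ d ∂ν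
  set K := ∫⁻ x, V x ∂ν
  set J' := ∫⁻ x in {x | e * T < F x}, F x ^ d ∂ν with hJ'
  set K' := ∫⁻ x in {x | e * T < V x}, V x ∂ν with hK'
  have hJ : J ≤ J' + (e * T) ^ d * M := by
    rw [hJ', ← lintegral_indicator (measurableSet_lt measurable_const hF), hM, ← lintegral_const,
      ← lintegral_add_right _ measurable_const]
    apply lintegral_mono
    intro x
    by_cases hx : e * T < F x
    · simp [Set.indicator, hx]
    · simp only [Set.indicator, Set.mem_ofPred_eq, hx, if_false, zero_add]
      exact ENNReal.rpow_le_rpow (not_lt.1 hx) hd0.le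
  have hK : K ≤ K' + (e * T) * M := by
    rw [hK', ← lintegral_indicator (measurableSet_lt measurable_const hV), hM, ← lintegral_const,
      ← lintegral_add_right _ measurable_const]
    apply lintegral_mono
    intro x
    by_cases hx : e * T < V x
    · simp [Set.indicator, hx]
    · simp only [Set.indicator, Set.mem_ofPred_eq, hx, if_false, zero_add]
      exact not_lt.1 hx
  have hee : e ≤ e ^ d := by
    conv_lhs => rw [← ENNReal.rpow_one e]
    exact ENNReal.rpow_le_rpow_of_exponent_ge he hd1.le
  have h2 : T ≤ 2 * C * (J / M) ^ (1 / d) ∨ T ≤ 2 * C * (K / M) := by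
    rcases le_total ((J / M) ^ (1 / d)) (K / M) with h3 | h3
    · right
      calc T ≤ _ := h
        _ ≤ C * (K / M + K / M) := by gcongr
        _ = _ := by ring
    · left
      calc T ≤ _ := h
        _ ≤ C * ((J / M) ^ (1 / d) + (J / M) ^ (1 / d)) := by gcongr
        _ = _ := by ring
  have h2C : (1:ℝ≥0∞) ≤ 2 * C := by
    calc (1:ℝ≥0∞) = 1 * 1 := by simp
      _ ≤ 2 * C := by gcongr; norm_num
  rcases h2 with h2 | h2
  · refine le_trans ?_ (le_add_right le_rfl)
    have h3 : T ^ d * M ≤ 2 * C * J := by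
      have : T ^ d ≤ 2 * C * (J / M) := by
        calc T ^ d ≤ (2 * C * (J / M) ^ (1 / d)) ^ d := ENNReal.rpow_le_rpow h2 hd0.le
          _ = (2 * C) ^ d * (J / M) := by
            rw [ENNReal.mul_rpow_of_nonneg _ _ hd0.le, ← ENNReal.rpow_mul]
            rw [one_div_mul_cancel hd0.ne', ENNReal.rpow_one]
          _ ≤ (2 * C) ^ (1:ℝ) * (J / M) := by
            gcongr
          _ = _ := by rw [ENNReal.rpow_one]
      calc T ^ d * M ≤ 2 * C * (J / M) * M := by gcongr
        _ = 2 * C * J := by rw [mul_assoc, ENNReal.div_mul_cancel hν hMt]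
    have h4 : T ^ d * M ≤ 2 * (2 * C * J') := by
      apply gh_absorb (h := 2 * C * ((e * T) ^ d * M))
      · exact ENNReal.mul_ne_top (ENNReal.rpow_ne_top_of_nonneg hd0.le hT) hMt
      · rw [ENNReal.mul_rpow_of_nonneg _ _ hd0.le]
        calc _ = (e ^ d * (4 * C)) * (T ^ d * M) := by ring
          _ ≤ 1 * (T ^ d * M) := by gcongr
          _ = _ := one_mul _
      · rw [← mul_add]
        exact h3.trans (by gcongr)
    calc T * M = T ^ (1 - d) * (T ^ d * M) := by
          rw [← mul_assoc, ← ENNReal.rpow_add _ _ hT0 hT]; simp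
      _ ≤ T ^ (1 - d) * (2 * (2 * C * J')) := by gcongr
      _ = _ := by ring
  · refine le_trans ?_ (le_add_left le_rfl)
    have h3 : T * M ≤ 2 * C * K := by
      calc T * M ≤ 2 * C * (K / M) * M := by gcongr
        _ = 2 * C * K := by rw [mul_assoc, ENNReal.div_mul_cancel hν hMt]
    calc T * M ≤ 2 * (2 * C * K') := by
          apply gh_absorb (h := 2 * C * ((e * T) * M))
          · exact ENNReal.mul_ne_top hT hMt
          · calc _ = (e * (4 * C)) * (T * M) := by ring
              _ ≤ (e ^ d * (4 * C)) * (T * M) := by gcongr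
              _ ≤ 1 * (T * M) := by gcongr
              _ = _ := one_mul _
          · rw [← mul_add]
            exact h3.trans (by gcongr)
      _ = _ := by ring

lemma gh_improve {α : Type*} [MeasurableSpace α] (μ : Measure α) {F V : α → ℝ≥0∞}
    (hF : Measurable F) (hV : Measurable V) (hFf : ∀ x, F x ≠ ∞) (hVf : ∀ x, V x ≠ ∞)
    (hI : ∫⁻ x, F x ∂μ ≠ ∞) {A η L : ℝ≥0∞} {d δ : ℝ} (hd0 : 0 < d) (hd1 : d < 1)
    (hη0 : η ≠ 0) (hη1 : η ≤ 1) (hδ : 0 < δ) (hδ1 : δ ≤ 1)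
    (hsm : A * ENNReal.ofReal δ * ENNReal.ofReal (1 / (1 - d)) * (η⁻¹) ^ (2:ℝ) * 2 ≤ 1)
    (hL : L ≠ ∞)
    (h : ∀ t : ℝ, 0 < t → L ≤ ENNReal.ofReal t →
      ∫⁻ x in {x | ENNReal.ofReal t < F x}, F x ∂μ ≤
        A * (ENNReal.ofReal t ^ (1 - d) * ∫⁻ x in {x | η * ENNReal.ofReal t < F x}, F x ^ d ∂μ) +
        A * ∫⁻ x in {x | η * ENNReal.ofReal t < V x}, V x ∂μ) :
    ∫⁻ x, F x ^ (1 + δ) ∂μ ≤ 2 * (L ^ δ * ∫⁻ x, F x ∂μ + A * (η⁻¹) ^ δ * ∫⁻ x, V x ^ (1 + δ) ∂μ) := by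
  have hηt : η ≠ ∞ := ne_top_of_le_ne_top ENNReal.one_ne_top hη1
  have hηi : η⁻¹ ≠ ∞ := ENNReal.inv_ne_top.2 hη0
  have hlt : ∀ (t : ℝ) (a : ℝ≥0∞), η * ENNReal.ofReal t < a ↔ ENNReal.ofReal t < η⁻¹ * a := by
    intro t a
    rw [mul_comm η⁻¹, ← div_eq_mul_inv, ENNReal.lt_div_iff_mul_lt (Or.inl hη0) (Or.inl hηt), mul_comm]
  set q : ℝ := 1 + δ - d with hq
  have hq0 : 0 < q := by linarith
  set X := L ^ δ * ∫⁻ x, F x ∂μ + A * (η⁻¹) ^ δ * ∫⁻ x, V x ^ (1 + δ) ∂μ with hX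
  have key : ∀ k : ℕ, ∫⁻ x, F x * (min (F x) k) ^ δ ∂μ ≤ 2 * X := by
    intro k
    have hfm : Measurable fun x => min (F x) (k:ℝ≥0∞) := hF.min measurable_const
    have hfm2 : Measurable fun x => min (η⁻¹ * F x) (k:ℝ≥0∞) := (hF.const_mul _).min measurable_const
    set I := ∫⁻ x, F x * (min (F x) k) ^ δ ∂μ with hIdef
    have hfin : I ≠ ∞ := by
      have : I ≤ (∫⁻ x, F x ∂μ) * (k:ℝ≥0∞) ^ δ := by
        rw [hIdef, ← lintegral_mul_const _ hF]
        gcongr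
        exact min_le_right _ _
      refine ne_top_of_le_ne_top (ENNReal.mul_ne_top hI ?_) this
      exact ENNReal.rpow_ne_top_of_nonneg hδ.le (by simp)
    have l1 := gh_layer μ hfm hF (fun x => by simp) hδ
    have l2 := gh_layer μ (H := fun _ => L) measurable_const hF (fun x => hL) hδ
    have l3 := gh_layer μ hfm2 (hF.pow_const d) (fun x => by simp) hq0
    have l4 := gh_layer μ (hV.const_mul η⁻¹) hV (fun x => ENNReal.mul_ne_top hηi (hVf x)) hδ
    set Φ2 : ℝ → ℝ≥0∞ := fun t => (∫⁻ x in {x | ENNReal.ofReal t < L}, F x ∂μ) *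
        ENNReal.ofReal (t ^ (δ - 1))
    set Φ3 : ℝ → ℝ≥0∞ := fun t => (∫⁻ x in {x | ENNReal.ofReal t < min (η⁻¹ * F x) k}, F x ^ d ∂μ) *
        ENNReal.ofReal (t ^ (q - 1))
    set Φ4 : ℝ → ℝ≥0∞ := fun t => (∫⁻ x in {x | ENNReal.ofReal t < η⁻¹ * V x}, V x ∂μ) *
        ENNReal.ofReal (t ^ (δ - 1))
    have mono_meas : ∀ (H W : α → ℝ≥0∞), Measurable (fun t : ℝ =>
        ∫⁻ x in {x | ENNReal.ofReal t < H x}, W x ∂μ) := by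
      intro H W
      apply Antitone.measurable
      intro s t hst
      apply lintegral_mono_set
      intro x hx
      exact lt_of_le_of_lt (ENNReal.ofReal_le_ofReal hst) hx
    have m2 : Measurable Φ2 := (mono_meas _ _).mul (by fun_prop)
    have m3 : Measurable Φ3 := (mono_meas _ _).mul (by fun_prop)
    have m4 : Measurable Φ4 := (mono_meas _ _).mul (by fun_prop)
    have pt : ∀ t ∈ Set.Ioi (0:ℝ), (∫⁻ x in {x | ENNReal.ofReal t < min (F x) k}, F x ∂μ) *
        ENNReal.ofReal (t ^ (δ - 1)) ≤ Φ2 t + A * Φ3 t + A * Φ4 t := by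
      intro t ht
      have ht : 0 < t := ht
      rcases lt_or_ge (ENNReal.ofReal t) L with hc | hc
      · refine le_trans ?_ (le_trans (le_add_right le_rfl) (le_add_right le_rfl))
        simp only [Φ2, hc, Set.ofPred_true]
        gcongr
        exact Set.subset_univ _
      · rcases lt_or_ge (ENNReal.ofReal t) (k:ℝ≥0∞) with hk | hk
        · have e0 := h t ht hc
          have hpow : ENNReal.ofReal t ^ (1 - d) * ENNReal.ofReal (t ^ (δ - 1)) =
              ENNReal.ofReal (t ^ (q - 1)) := by
            rw [ENNReal.ofReal_rpow_of_pos ht, ← ENNReal.ofReal_mul (by positivity),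
              ← Real.rpow_add ht]
            congr 2
            rw [hq]; ring
          simp only [hlt] at e0
          simp only [Φ3, Φ4, lt_min_iff, hk, and_true]
          calc _ ≤ _ := mul_le_mul_left e0 _
            _ = A * ((∫⁻ x in {x | ENNReal.ofReal t < η⁻¹ * F x}, F x ^ d ∂μ) *
                (ENNReal.ofReal t ^ (1 - d) * ENNReal.ofReal (t ^ (δ - 1)))) + _ := by
                  rw [add_mul]; congr 1; ring
            _ ≤ Φ2 t + (A * ((∫⁻ x in {x | ENNReal.ofReal t < η⁻¹ * F x}, F x ^ d ∂μ) *
                (ENNReal.ofReal t ^ (1 - d) * ENNReal.ofReal (t ^ (δ - 1)))) + _) := le_add_left le_rfl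
            _ = _ := by rw [hpow, ← add_assoc, mul_assoc A _ (ENNReal.ofReal (t ^ (δ - 1)))]
        · have : {x | ENNReal.ofReal t < min (F x) (k:ℝ≥0∞)} = ∅ := by
            ext x
            simp [hk]
          rw [this]; simp
    have s1 : I ≤ ENNReal.ofReal δ * (∫⁻ t in Set.Ioi (0:ℝ), Φ2 t) +
        A * ENNReal.ofReal δ * (∫⁻ t in Set.Ioi (0:ℝ), Φ3 t) +
        A * (ENNReal.ofReal δ * (∫⁻ t in Set.Ioi (0:ℝ), Φ4 t)) := by
      rw [hIdef, l1]
      calc _ ≤ ENNReal.ofReal δ * ∫⁻ t in Set.Ioi (0:ℝ), (Φ2 t + A * Φ3 t + A * Φ4 t) :=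
            mul_le_mul_right (setLIntegral_mono' measurableSet_Ioi pt) _
        _ = _ := by
          rw [lintegral_add_right _ (m4.const_mul _), lintegral_add_right _ (m3.const_mul _),
            lintegral_const_mul _ m3, lintegral_const_mul _ m4]
          ring
    rw [← l2, ← l4] at s1
    have s3 : A * ENNReal.ofReal δ * (∫⁻ t in Set.Ioi (0:ℝ), Φ3 t) * 2 ≤ I := by
      have e1 : ENNReal.ofReal (1 / q) * ENNReal.ofReal q = 1 := by
        rw [← ENNReal.ofReal_mul (by positivity), one_div_mul_cancel hq0.ne', ENNReal.ofReal_one]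
      have e2 : (∫⁻ t in Set.Ioi (0:ℝ), Φ3 t) = ENNReal.ofReal (1 / q) *
          ∫⁻ x, F x ^ d * (min (η⁻¹ * F x) k) ^ q ∂μ := by
        rw [l3, ← mul_assoc, e1, one_mul]
      have e3 : ∫⁻ x, F x ^ d * (min (η⁻¹ * F x) k) ^ q ∂μ ≤ (η⁻¹) ^ (2:ℝ) * I := by
        have mm : Measurable fun x => F x * (min (F x) (k:ℝ≥0∞)) ^ δ := hF.mul (hfm.pow_const _)
        rw [hIdef, ← lintegral_const_mul _ mm]
        apply lintegral_mono
        intro x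
        simp only
        have one_le : 1 ≤ η⁻¹ := ENNReal.one_le_inv.2 hη1
        have a1 : min (η⁻¹ * F x) k ≤ η⁻¹ * min (F x) k := by
          rcases le_total (F x) k with hh | hh
          · rw [min_eq_left hh]; exact min_le_left _ _
          · rw [min_eq_right hh]
            refine (min_le_right _ _).trans ?_
            calc (k:ℝ≥0∞) = 1 * k := by simp
              _ ≤ _ := by gcongr
        have a2 : (η⁻¹ * min (F x) k) ^ q ≤ (η⁻¹) ^ (2:ℝ) * (min (F x) k) ^ q := by
          rw [ENNReal.mul_rpow_of_nonneg _ _ hq0.le]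
          gcongr
          linarith
        have a3 : F x ^ d * (min (F x) k) ^ q ≤ F x * (min (F x) k) ^ δ := by
          have : q = (1 - d) + δ := by rw [hq]; ring
          rw [this, ENNReal.rpow_add_of_nonneg _ _ (by linarith) hδ.le, ← mul_assoc]
          gcongr
          calc F x ^ d * (min (F x) k) ^ (1 - d) ≤ F x ^ d * F x ^ (1 - d) := by
                have := sub_pos.2 hd1
                exact mul_le_mul_right (ENNReal.rpow_le_rpow (min_le_left _ _) this.le) _
            _ = F x := by
              rw [← ENNReal.rpow_add_of_nonneg _ _ hd0.le (by linarith)]; simp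
        calc _ ≤ F x ^ d * ((η⁻¹) ^ (2:ℝ) * (min (F x) k) ^ q) := by
              gcongr
              exact (ENNReal.rpow_le_rpow a1 hq0.le).trans a2
          _ = (η⁻¹) ^ (2:ℝ) * (F x ^ d * (min (F x) k) ^ q) := by ring
          _ ≤ _ := by gcongr
      rw [e2]
      calc _ ≤ A * ENNReal.ofReal δ * (ENNReal.ofReal (1 / (1 - d)) * ((η⁻¹) ^ (2:ℝ) * I)) * 2 := by
            gcongr
            linarith
        _ = (A * ENNReal.ofReal δ * ENNReal.ofReal (1 / (1 - d)) * (η⁻¹) ^ (2:ℝ) * 2) * I := by ring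
        _ ≤ 1 * I := by gcongr
        _ = I := one_mul _
    have s4 : ∫⁻ x, F x * L ^ δ ∂μ + A * ∫⁻ x, V x * (η⁻¹ * V x) ^ δ ∂μ = X := by
      rw [hX, lintegral_mul_const _ hF, mul_comm (L ^ δ), mul_assoc A,
        ← lintegral_const_mul _ (hV.pow_const _)]
      congr 3
      ext x
      rw [ENNReal.mul_rpow_of_nonneg _ _ hδ.le, ENNReal.rpow_add_of_nonneg _ _ zero_le_one hδ.le,
        ENNReal.rpow_one]
      ring
    refine gh_absorb hfin s3 (s1.trans (le_of_eq ?_))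
    rw [← s4]; ring
  have htend : Filter.Tendsto (fun k : ℕ => ∫⁻ x, F x * (min (F x) k) ^ δ ∂μ) Filter.atTop
      (nhds (∫⁻ x, F x ^ (1 + δ) ∂μ)) := by
    apply lintegral_tendsto_of_tendsto_of_monotone
    · intro k
      exact (hF.mul ((hF.min measurable_const).pow_const _)).aemeasurable
    · refine Filter.Eventually.of_forall fun x => ?_
      intro a b hab
      simp only
      gcongr
    · refine Filter.Eventually.of_forall fun x => ?_
      obtain ⟨m, hm⟩ := ENNReal.exists_nat_gt (hFf x)
      apply tendsto_const_nhds.congr'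
      filter_upwards [Filter.eventually_ge_atTop m] with k hk
      rw [min_eq_left, ENNReal.rpow_add_of_nonneg _ _ zero_le_one hδ.le, ENNReal.rpow_one]
      exact hm.le.trans (by exact_mod_cast hk)
  exact le_of_tendsto' htend key

lemma gh_cover {N : ℕ} (y : EuclideanSpace ℝ (Fin N)) {R : ℝ}
    {F V : EuclideanSpace ℝ (Fin N) → ℝ≥0∞}
    (hF : Measurable F) (hV : Measurable V) (hI : ∫⁻ x, F x ≠ ∞)
    {T e C L : ℝ≥0∞} {d : ℝ} (hd0 : 0 < d) (hd1 : d < 1) (hT0 : T ≠ 0) (hT : T ≠ ∞)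
    (hC1 : 1 ≤ C) (he : e ≤ 1) (hed : e ^ d * (4 * C) ≤ 1) (hLT : L ≤ T)
    (H1 : ∀ x ∈ Metric.ball y R, ∀ r, 0 < r → r ≤ (R - dist x y) / 20 →
      ∫⁻ z in Metric.closedBall x r, F z ≤ volume (Metric.closedBall x r) *
        (C * (((∫⁻ z in Metric.closedBall x (2 * r), F z ^ d) /
          volume (Metric.closedBall x (2 * r))) ^ (1 / d) +
          (∫⁻ z in Metric.closedBall x (2 * r), V z) / volume (Metric.closedBall x (2 * r)))))
    (H2 : ∀ x ∈ Metric.ball y R, ∀ r, (R - dist x y) / 20 < r → r ≤ (R - dist x y) / 2 →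
      ∫⁻ z in Metric.closedBall x r, F z ≤ L * volume (Metric.closedBall x r)) :
    ∫⁻ x in {x | T < F x}, F x ∂(volume.restrict (Metric.ball y R)) ≤
      (5 ^ N * (4 * C)) * (T ^ (1 - d) *
        ∫⁻ x in {x | e * T < F x}, F x ^ d ∂(volume.restrict (Metric.ball y R))) +
      (5 ^ N * (4 * C)) * ∫⁻ x in {x | e * T < V x}, V x ∂(volume.restrict (Metric.ball y R)) := by
  have hleb : ∀ᵐ x : EuclideanSpace ℝ (Fin N), Filter.Tendsto
      (fun r => (∫⁻ z in Metric.closedBall x r, F z) / volume (Metric.closedBall x r))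
      (nhdsWithin 0 (Set.Ioi 0)) (nhds (F x)) := by
    filter_upwards [(Besicovitch.vitaliFamily
      (volume : Measure (EuclideanSpace ℝ (Fin N)))).ae_tendsto_lintegral_div hF.aemeasurable hI]
      with x hx
    exact hx.comp (Besicovitch.tendsto_filterAt _ x)
  have vpos : ∀ (x : EuclideanSpace ℝ (Fin N)) (r : ℝ), 0 < r → volume (Metric.closedBall x r) ≠ 0 :=
    fun x r hr => (Metric.measure_closedBall_pos volume x hr).ne'
  have vfin : ∀ (x : EuclideanSpace ℝ (Fin N)) (r : ℝ), volume (Metric.closedBall x r) ≠ ∞ :=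
    fun x r => measure_closedBall_lt_top.ne
  set S : Set (EuclideanSpace ℝ (Fin N)) := {x | x ∈ Metric.ball y R ∧ T < F x ∧ Filter.Tendsto
      (fun r => (∫⁻ z in Metric.closedBall x r, F z) / volume (Metric.closedBall x r))
      (nhdsWithin 0 (Set.Ioi 0)) (nhds (F x))} with hS
  have hradius : ∀ x ∈ S, ∃ r, 0 < r ∧ r ≤ (R - dist x y) / 20 ∧
      T * volume (Metric.closedBall x r) ≤ ∫⁻ z in Metric.closedBall x r, F z ∧
      ∫⁻ z in Metric.closedBall x (10 * r), F z ≤ T * volume (Metric.closedBall x (10 * r)) := by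
    rintro x ⟨hxB, hTx, hx⟩
    have hD : 0 < R - dist x y := sub_pos.2 (Metric.mem_ball.1 hxB)
    set D := R - dist x y
    set P : Set ℝ := {r | 0 < r ∧ r ≤ D / 2 ∧
      T * volume (Metric.closedBall x r) < ∫⁻ z in Metric.closedBall x r, F z} with hP
    have hne : P.Nonempty := by
      have h1 := hx.eventually (lt_mem_nhds hTx)
      have h2 : ∀ᶠ r in nhdsWithin (0:ℝ) (Set.Ioi 0), r ∈ Set.Ioo (0:ℝ) (D / 2) :=
        Ioo_mem_nhdsGT (by linarith)
      obtain ⟨r, hr1, hr2⟩ := (h1.and h2).exists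
      refine ⟨r, hr2.1, hr2.2.le, ?_⟩
      exact (ENNReal.lt_div_iff_mul_lt (Or.inl (vpos x r hr2.1)) (Or.inl (vfin x r))).1 hr1
    have hbdd : BddAbove P := ⟨D / 2, fun r hr => hr.2.1⟩
    have hsp : 0 < sSup P := by
      obtain ⟨r, hr⟩ := hne
      exact hr.1.trans_le (le_csSup hbdd hr)
    obtain ⟨r, hr, hrs⟩ := exists_lt_of_lt_csSup hne (half_lt_self hsp)
    have hr20 : r ≤ D / 20 := by
      by_contra hcon
      have := H2 x hxB r (not_le.1 hcon) hr.2.1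
      exact absurd (this.trans (by gcongr)) (not_le.2 hr.2.2)
    refine ⟨r, hr.1, hr20, hr.2.2.le, ?_⟩
    by_contra hcon
    have : 10 * r ∈ P := ⟨by linarith [hr.1], by linarith, not_le.1 hcon⟩
    have := le_csSup hbdd this
    linarith [hr.1]
  choose! ρ hρ0 hρ1 hρ2 hρ3 using hradius
  obtain ⟨u, huS, hdisj, hcov⟩ := Vitali.exists_disjoint_subfamily_covering_enlargement_closedBall
    S id (fun x => 2 * ρ x) (R / 10) (fun a ha => by
      have := hρ1 a ha; have := dist_nonneg (x := a) (y := y); linarith) 5 (by norm_num)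
  simp only [id] at hdisj hcov
  have hcount : u.Countable := by
    apply hdisj.countable_of_nonempty_interior
    intro x hx
    have := hρ0 x (huS hx)
    exact ⟨x, mem_interior_iff_mem_nhds.2 (Metric.closedBall_mem_nhds x (by linarith))⟩
  have : Countable u := hcount.to_subtype
  have hsub : ∀ x ∈ u, Metric.closedBall x (2 * ρ x) ⊆ Metric.ball y R := by
    intro x hx z hz
    have h1 := hρ1 x (huS hx)
    have h0 := hρ0 x (huS hx)
    have h2 := dist_triangle z x y
    rw [Metric.mem_closedBall] at hz
    rw [Metric.mem_ball]
    linarith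
  have per : ∀ x ∈ u, ∫⁻ z in Metric.closedBall x (10 * ρ x), F z ≤
      5 ^ N * (4 * C * (T ^ (1 - d) * ∫⁻ z in Metric.closedBall x (2 * ρ x),
        {x | e * T < F x}.indicator (fun x => F x ^ d) z) +
      4 * C * ∫⁻ z in Metric.closedBall x (2 * ρ x), {x | e * T < V x}.indicator V z) := by
    intro x hx
    have h0 := hρ0 x (huS hx)
    have hv : volume (Metric.closedBall x (10 * ρ x)) =
        5 ^ N * volume (Metric.closedBall x (2 * ρ x)) := by
      rw [Measure.addHaar_closedBall _ _ (by linarith), Measure.addHaar_closedBall _ _ (by linarith),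
        ← mul_assoc]
      congr 1
      rw [finrank_euclideanSpace_fin, show (5:ℝ≥0∞) ^ N = ENNReal.ofReal (5 ^ N) by
        rw [ENNReal.ofReal_pow (by norm_num)]; norm_num, ← ENNReal.ofReal_mul (by positivity), ← mul_pow]
      congr 2; ring
    refine (hρ3 x (huS hx)).trans ?_
    rw [hv]
    have : IsFiniteMeasure (volume.restrict (Metric.closedBall x (2 * ρ x))) :=
      ⟨by rw [Measure.restrict_apply_univ]; exact (vfin _ _).lt_top⟩
    have key := gh_perball (volume.restrict (Metric.closedBall x (2 * ρ x)))
      (by rw [Measure.restrict_apply_univ]; exact vpos _ _ (by linarith)) hF hV (T := T) (e := e)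
      (C := C) hd0 hd1 hT0 hT hC1 he hed (by
        rw [Measure.restrict_apply_univ]
        have h1 := (hρ2 x (huS hx)).trans
          (H1 x (huS hx).1 (ρ x) h0 (hρ1 x (huS hx)))
        rw [mul_comm T] at h1
        exact (ENNReal.mul_le_mul_iff_right (vpos _ _ h0) (vfin _ _)).1 h1)
    rw [Measure.restrict_apply_univ] at key
    rw [lintegral_indicator (measurableSet_lt measurable_const hF),
      lintegral_indicator (measurableSet_lt measurable_const hV)]
    calc _ = 5 ^ N * (T * volume (Metric.closedBall x (2 * ρ x))) := by ring
      _ ≤ _ := by gcongr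
  have sumle : ∀ W : EuclideanSpace ℝ (Fin N) → ℝ≥0∞,
      ∑' x : u, ∫⁻ z in Metric.closedBall (x:EuclideanSpace ℝ (Fin N)) (2 * ρ x), W z ≤
      ∫⁻ z in Metric.ball y R, W z := by
    intro W
    rw [← lintegral_biUnion hcount (fun i _ => measurableSet_closedBall) hdisj W]
    exact lintegral_mono_set (Set.iUnion₂_subset hsub)
  have hmF := measurableSet_lt (measurable_const (a := T)) hF
  have hfirst : ∫⁻ x in {x | T < F x}, F x ∂(volume.restrict (Metric.ball y R)) ≤
      ∫⁻ x in ⋃ b : u, Metric.closedBall (b:EuclideanSpace ℝ (Fin N)) (10 * ρ b), F x := by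
    rw [Measure.restrict_restrict hmF]
    apply lintegral_mono_set'
    filter_upwards [hleb] with x hx hxm
    have hxS : x ∈ S := ⟨hxm.2, hxm.1, hx⟩
    obtain ⟨b, hb, hsubb⟩ := hcov x hxS
    have : x ∈ Metric.closedBall b (5 * (2 * ρ b)) :=
      hsubb (Metric.mem_closedBall_self (by linarith [hρ0 x hxS]))
    refine Set.mem_iUnion.2 ⟨⟨b, hb⟩, ?_⟩
    rw [show (10:ℝ) * ρ b = 5 * (2 * ρ b) by ring]
    exact this
  refine hfirst.trans ((lintegral_iUnion_le _ _).trans ?_)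
  refine (ENNReal.tsum_le_tsum fun b : u => per b b.2).trans ?_
  rw [ENNReal.tsum_mul_left, ENNReal.tsum_add, ENNReal.tsum_mul_left, ENNReal.tsum_mul_left,
    ENNReal.tsum_mul_left, mul_add]
  rw [← lintegral_indicator (measurableSet_lt measurable_const hF),
    ← lintegral_indicator (measurableSet_lt measurable_const hV)]
  simp only [mul_assoc]
  gcongr
  · exact sumle _
  · exact sumle _

lemma gh_core {N : ℕ} (y : EuclideanSpace ℝ (Fin N)) {R : ℝ} (hR : 0 < R)
    {f u : EuclideanSpace ℝ (Fin N) → ℝ≥0∞} (hf : Measurable f) (hu : Measurable u)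
    (hff : ∀ x, f x ≠ ∞) (huf : ∀ x, u x ≠ ∞) (hI : ∫⁻ x, f x ≠ ∞)
    {c e : ℝ≥0∞} {d δ : ℝ} (hd0 : 0 < d) (hd1 : d < 1) (hδ : 0 < δ) (hδ1 : δ ≤ 1)
    (hc1 : 1 ≤ c) (he0 : e ≠ 0) (he : e ≤ 1) (hed : e ^ d * (4 * (c * 3 ^ N)) ≤ 1)
    (hsm : (5 ^ N * (4 * (c * 3 ^ N))) * ENNReal.ofReal δ * ENNReal.ofReal (1 / (1 - d)) *
      (e⁻¹) ^ (2:ℝ) * 2 ≤ 1)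
    (H : ∀ x r, 0 < r → Metric.closedBall x (2 * r) ⊆ Metric.ball y R →
      ∫⁻ z in Metric.closedBall x r, f z ≤ volume (Metric.closedBall x r) *
        (c * (((∫⁻ z in Metric.closedBall x (2 * r), f z ^ d) /
          volume (Metric.closedBall x (2 * r))) ^ (1 / d) +
          (∫⁻ z in Metric.closedBall x (2 * r), u z) / volume (Metric.closedBall x (2 * r))))) :
    ∫⁻ x in Metric.ball y (R / 2), f x ^ (1 + δ) ≤
      (2 * 4 ^ N * (30 ^ N + 5 ^ N * (4 * (c * 3 ^ N)) * e⁻¹)) *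
      (((∫⁻ x in Metric.ball y R, f x) / volume (Metric.ball y R)) ^ δ *
        (∫⁻ x in Metric.ball y R, f x) + ∫⁻ x in Metric.ball y R, u x ^ (1 + δ)) := by
  set a : EuclideanSpace ℝ (Fin N) → ℝ≥0∞ := fun x => ENNReal.ofReal ((R - dist x y) / R) ^ N with ha
  have ham : Measurable a := by
    have : Measurable fun x : EuclideanSpace ℝ (Fin N) => ENNReal.ofReal ((R - dist x y) / R) :=
      (ENNReal.continuous_ofReal.comp (by fun_prop)).measurable
    exact this.pow_const N
  have ha1 : ∀ x, a x ≤ 1 := by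
    intro x
    apply pow_le_one'
    rw [ENNReal.ofReal_le_one, div_le_one hR]
    linarith [dist_nonneg (x := x) (y := y)]
  have hat : ∀ x, a x ≠ ∞ := fun x => ne_top_of_le_ne_top ENNReal.one_ne_top (ha1 x)
  set F := fun x => f x * a x with hFdef
  set V := fun x => u x * a x with hVdef
  have hFm : Measurable F := hf.mul ham
  have hVm : Measurable V := hu.mul ham
  have hFf : ∀ x, F x ≤ f x := fun x => by
    calc f x * a x ≤ f x * 1 := by gcongr; exact ha1 x
      _ = _ := mul_one _
  have hVu : ∀ x, V x ≤ u x := fun x => by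
    calc u x * a x ≤ u x * 1 := by gcongr; exact ha1 x
      _ = _ := mul_one _
  have hIF : ∫⁻ x, F x ≠ ∞ := ne_top_of_le_ne_top hI (lintegral_mono hFf)
  set B := Metric.ball y R with hB
  set av := (∫⁻ x in B, f x) / volume B with hav
  have hvB0 : volume B ≠ 0 := (Metric.measure_ball_pos volume y hR).ne'
  have hvBt : volume B ≠ ∞ := measure_ball_lt_top.ne
  have hIB : ∫⁻ x in B, f x ≠ ∞ := ne_top_of_le_ne_top hI (setLIntegral_le_lintegral _ _)
  have havt : av ≠ ∞ := ENNReal.div_ne_top hIB hvB0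
  set P : EuclideanSpace ℝ (Fin N) → ℝ≥0∞ :=
    fun x => ENNReal.ofReal (3 * (R - dist x y) / (2 * R)) ^ N with hPdef
  have hP : ∀ x ∈ B, ∀ z ∈ Metric.closedBall x ((R - dist x y) / 2), a z ≤ P x ∧ P x ≤ 3 ^ N * a z := by
    intro x hx z hz
    rw [Metric.mem_closedBall] at hz
    have t1 := dist_triangle z x y
    have t2 := dist_triangle x z y
    rw [dist_comm x z] at t2
    refine ⟨?_, ?_⟩
    · simp only [ha, hPdef]
      gcongr ?_ ^ N
      apply ENNReal.ofReal_le_ofReal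
      rw [div_le_div_iff₀ hR (by linarith)]
      nlinarith
    · simp only [ha, hPdef]
      rw [← mul_pow]
      gcongr ?_ ^ N
      rw [show (3:ℝ≥0∞) = ENNReal.ofReal 3 by norm_num, ← ENNReal.ofReal_mul (by norm_num)]
      apply ENNReal.ofReal_le_ofReal
      rw [← mul_div_assoc, div_le_div_iff₀ (by linarith) hR]
      nlinarith
  have hPt : ∀ x, P x ≠ ∞ := fun x => ENNReal.pow_ne_top ENNReal.ofReal_ne_top
  have H1 : ∀ x ∈ B, ∀ r, 0 < r → r ≤ (R - dist x y) / 20 →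
      ∫⁻ z in Metric.closedBall x r, F z ≤ volume (Metric.closedBall x r) *
        ((c * 3 ^ N) * (((∫⁻ z in Metric.closedBall x (2 * r), F z ^ d) /
          volume (Metric.closedBall x (2 * r))) ^ (1 / d) +
          (∫⁻ z in Metric.closedBall x (2 * r), V z) / volume (Metric.closedBall x (2 * r)))) := by
    intro x hx r hr0 hr
    have hD : 0 < R - dist x y := sub_pos.2 (Metric.mem_ball.1 hx)
    set v := volume (Metric.closedBall x (2 * r))
    have hs1 : Metric.closedBall x r ⊆ Metric.closedBall x ((R - dist x y) / 2) :=
      Metric.closedBall_subset_closedBall (by linarith)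
    have hs2 : Metric.closedBall x (2 * r) ⊆ Metric.closedBall x ((R - dist x y) / 2) :=
      Metric.closedBall_subset_closedBall (by linarith)
    have hs3 : Metric.closedBall x (2 * r) ⊆ B := by
      intro z hz
      rw [Metric.mem_closedBall] at hz
      have t1 := dist_triangle z x y
      rw [hB, Metric.mem_ball]; linarith
    have b1 : ∫⁻ z in Metric.closedBall x r, F z ≤ P x * ∫⁻ z in Metric.closedBall x r, f z := by
      rw [← lintegral_const_mul _ hf]
      apply setLIntegral_mono' measurableSet_closedBall
      intro z hz
      simp only [hFdef]
      rw [mul_comm]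
      gcongr
      exact (hP x hx z (hs1 hz)).1
    have b2 : P x * ((∫⁻ z in Metric.closedBall x (2 * r), f z ^ d) / v) ^ (1 / d) ≤
        3 ^ N * ((∫⁻ z in Metric.closedBall x (2 * r), F z ^ d) / v) ^ (1 / d) := by
      have hd' : 0 ≤ 1 / d := by positivity
      have id1 : ∀ q : ℝ≥0∞, q = (q ^ d) ^ (1 / d) := by
        intro q
        rw [← ENNReal.rpow_mul, mul_one_div_cancel hd0.ne', ENNReal.rpow_one]
      rw [id1 (P x), id1 (3 ^ N), ← ENNReal.mul_rpow_of_nonneg _ _ hd',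
        ← ENNReal.mul_rpow_of_nonneg _ _ hd']
      apply ENNReal.rpow_le_rpow _ hd'
      rw [← mul_div_assoc, ← mul_div_assoc]
      apply ENNReal.div_le_div_right
      rw [← lintegral_const_mul _ (hf.pow_const _), ← lintegral_const_mul _ (hFm.pow_const _)]
      apply setLIntegral_mono' measurableSet_closedBall
      intro z hz
      rw [← ENNReal.mul_rpow_of_nonneg _ _ hd0.le, ← ENNReal.mul_rpow_of_nonneg _ _ hd0.le]
      apply ENNReal.rpow_le_rpow _ hd0.le
      calc P x * f z ≤ (3 ^ N * a z) * f z := by gcongr; exact (hP x hx z (hs2 hz)).2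
        _ = _ := by simp only [hFdef]; ring
    have b3 : P x * ((∫⁻ z in Metric.closedBall x (2 * r), u z) / v) ≤
        3 ^ N * ((∫⁻ z in Metric.closedBall x (2 * r), V z) / v) := by
      rw [← mul_div_assoc, ← mul_div_assoc]
      apply ENNReal.div_le_div_right
      rw [← lintegral_const_mul _ hu, ← lintegral_const_mul _ hVm]
      apply setLIntegral_mono' measurableSet_closedBall
      intro z hz
      calc P x * u z ≤ (3 ^ N * a z) * u z := by gcongr; exact (hP x hx z (hs2 hz)).2
        _ = _ := by simp only [hVdef]; ring
    calc _ ≤ _ := b1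
      _ ≤ P x * _ := mul_le_mul_right (H x r hr0 hs3) _
      _ = volume (Metric.closedBall x r) * (c *
          (P x * ((∫⁻ z in Metric.closedBall x (2 * r), f z ^ d) / v) ^ (1 / d) +
            P x * ((∫⁻ z in Metric.closedBall x (2 * r), u z) / v))) := by ring
      _ ≤ volume (Metric.closedBall x r) * (c *
          (3 ^ N * ((∫⁻ z in Metric.closedBall x (2 * r), F z ^ d) / v) ^ (1 / d) +
            3 ^ N * ((∫⁻ z in Metric.closedBall x (2 * r), V z) / v))) := by gcongr
      _ = _ := by ring
  have H2 : ∀ x ∈ B, ∀ r, (R - dist x y) / 20 < r → r ≤ (R - dist x y) / 2 →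
      ∫⁻ z in Metric.closedBall x r, F z ≤ (30 ^ N * av) * volume (Metric.closedBall x r) := by
    intro x hx r hr1 hr2
    have hD : 0 < R - dist x y := sub_pos.2 (Metric.mem_ball.1 hx)
    have hs1 : Metric.closedBall x r ⊆ Metric.closedBall x ((R - dist x y) / 2) :=
      Metric.closedBall_subset_closedBall (by linarith)
    have hs3 : Metric.closedBall x r ⊆ B := by
      intro z hz
      rw [Metric.mem_closedBall] at hz
      have t1 := dist_triangle z x y
      rw [hB, Metric.mem_ball]; linarith
    have hvol : P x * volume B ≤ 30 ^ N * volume (Metric.closedBall x r) := by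
      rw [Measure.addHaar_closedBall _ _ (by linarith), hB, Measure.addHaar_ball_of_pos _ _ hR,
        ← mul_assoc, ← mul_assoc, finrank_euclideanSpace_fin]
      gcongr ?_ * _
      rw [hPdef]
      simp only
      rw [ENNReal.ofReal_pow hR.le, ENNReal.ofReal_pow (by linarith), ← mul_pow, ← mul_pow]
      gcongr ?_ ^ N
      rw [show (30:ℝ≥0∞) = ENNReal.ofReal 30 by norm_num, ← ENNReal.ofReal_mul (div_nonneg (by linarith) (by linarith)),
        ← ENNReal.ofReal_mul (by norm_num)]
      apply ENNReal.ofReal_le_ofReal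
      have : 3 * (R - dist x y) / (2 * R) * R = 3 * (R - dist x y) / 2 := by field_simp
      rw [this]; linarith
    calc ∫⁻ z in Metric.closedBall x r, F z ≤ P x * ∫⁻ z in Metric.closedBall x r, f z := by
          rw [← lintegral_const_mul _ hf]
          apply setLIntegral_mono' measurableSet_closedBall
          intro z hz
          simp only [hFdef]
          rw [mul_comm]
          gcongr
          exact (hP x hx z (hs1 hz)).1
      _ ≤ P x * ∫⁻ z in B, f z := mul_le_mul_right (lintegral_mono_set hs3) _
      _ = P x * volume B * av := by rw [mul_assoc, hav, ENNReal.mul_div_cancel hvB0 hvBt]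
      _ ≤ 30 ^ N * volume (Metric.closedBall x r) * av := by gcongr
      _ = _ := by ring
  have hC1 : 1 ≤ c * 3 ^ N := by
    calc (1:ℝ≥0∞) = 1 * 1 := by simp
      _ ≤ _ := mul_le_mul' hc1 (one_le_pow₀ (by norm_num))
  have hLt : 30 ^ N * av ≠ ∞ := ENNReal.mul_ne_top (ENNReal.pow_ne_top (by norm_num)) havt
  have main := gh_improve (volume.restrict B) hFm hVm
    (fun x => ENNReal.mul_ne_top (hff x) (hat x)) (fun x => ENNReal.mul_ne_top (huf x) (hat x))
    (ne_top_of_le_ne_top hIF (setLIntegral_le_lintegral _ _)) (A := 5 ^ N * (4 * (c * 3 ^ N)))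
    (η := e) (L := 30 ^ N * av) hd0 hd1 he0 he hδ hδ1 hsm hLt
    (fun t ht hLT => gh_cover y hFm hVm hIF hd0 hd1 (by simpa using ht) ENNReal.ofReal_ne_top hC1
      he hed hLT H1 H2)
  have low : ∫⁻ x in Metric.ball y (R / 2), f x ^ (1 + δ) ≤ 4 ^ N * ∫⁻ x in B, F x ^ (1 + δ) := by
    calc ∫⁻ x in Metric.ball y (R / 2), f x ^ (1 + δ)
        ≤ ∫⁻ x in Metric.ball y (R / 2), 4 ^ N * F x ^ (1 + δ) := by
          apply setLIntegral_mono' measurableSet_ball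
          intro x hx
          rw [Metric.mem_ball] at hx
          have h1 : 1 ≤ 2 ^ N * a x := by
            simp only [ha]
            rw [← mul_pow]
            apply one_le_pow₀
            have h2 : ∀ q : ℝ, (2:ℝ≥0∞) * ENNReal.ofReal q = ENNReal.ofReal (2 * q) := by
              intro q
              rw [ENNReal.ofReal_mul (by norm_num)]; norm_num
            rw [h2, ENNReal.one_le_ofReal, ← mul_div_assoc, le_div_iff₀ hR]
            linarith
          have h2 : f x ≤ 2 ^ N * F x := by
            calc f x = 1 * f x := by simp
              _ ≤ (2 ^ N * a x) * f x := by gcongr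
              _ = _ := by simp only [hFdef]; ring
          calc f x ^ (1 + δ) ≤ (2 ^ N * F x) ^ (1 + δ) := ENNReal.rpow_le_rpow h2 (by linarith)
            _ = (2 ^ N) ^ (1 + δ) * F x ^ (1 + δ) := ENNReal.mul_rpow_of_nonneg _ _ (by linarith)
            _ ≤ (2 ^ N) ^ (2:ℝ) * F x ^ (1 + δ) := by
              gcongr
              · exact one_le_pow₀ (by norm_num)
              · linarith
            _ = _ := by
              congr 1
              rw [ENNReal.rpow_ofNat, ← pow_mul, mul_comm N 2, pow_mul]
              norm_num
      _ = 4 ^ N * ∫⁻ x in Metric.ball y (R / 2), F x ^ (1 + δ) :=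
          lintegral_const_mul _ (hFm.pow_const _)
      _ ≤ _ := by
        gcongr
        exact Metric.ball_subset_ball (by linarith)
  have hL1 : (30 ^ N * av) ^ δ ≤ 30 ^ N * av ^ δ := by
    rw [ENNReal.mul_rpow_of_nonneg _ _ hδ.le]
    gcongr
    calc ((30:ℝ≥0∞) ^ N) ^ δ ≤ (30 ^ N) ^ (1:ℝ) :=
          ENNReal.rpow_le_rpow_of_exponent_le (one_le_pow₀ (by norm_num)) hδ1
      _ = _ := ENNReal.rpow_one _
  have he1 : (e⁻¹) ^ δ ≤ e⁻¹ := by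
    calc (e⁻¹) ^ δ ≤ (e⁻¹) ^ (1:ℝ) :=
          ENNReal.rpow_le_rpow_of_exponent_le (ENNReal.one_le_inv.2 he) hδ1
      _ = _ := ENNReal.rpow_one _
  have i1 : ∫⁻ x in B, F x ≤ ∫⁻ x in B, f x := lintegral_mono hFf
  have i2 : ∫⁻ x in B, V x ^ (1 + δ) ≤ ∫⁻ x in B, u x ^ (1 + δ) :=
    lintegral_mono fun x => ENNReal.rpow_le_rpow (hVu x) (by linarith)
  set A := 5 ^ N * (4 * (c * 3 ^ N))
  calc _ ≤ _ := low
    _ ≤ 4 ^ N * (2 * ((30 ^ N * av ^ δ) * (∫⁻ x in B, f x) +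
        A * e⁻¹ * ∫⁻ x in B, u x ^ (1 + δ))) := by
      refine mul_le_mul_right (main.trans ?_) _
      gcongr
    _ = (2 * 4 ^ N) * (30 ^ N * (av ^ δ * ∫⁻ x in B, f x) +
        A * e⁻¹ * ∫⁻ x in B, u x ^ (1 + δ)) := by ring
    _ ≤ (2 * 4 ^ N) * ((30 ^ N + A * e⁻¹) * (av ^ δ * ∫⁻ x in B, f x) +
        (30 ^ N + A * e⁻¹) * ∫⁻ x in B, u x ^ (1 + δ)) := by
      gcongr
      · exact le_self_add
      · exact le_add_self
    _ = _ := by ring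

lemma gh_ball_ae {N : ℕ} (x : EuclideanSpace ℝ (Fin N)) {r : ℝ} (hr : 0 < r) :
    (Metric.ball x r : Set (EuclideanSpace ℝ (Fin N))) =ᵐ[volume] Metric.closedBall x r := by
  apply (HasSubset.Subset.eventuallyLE Metric.ball_subset_closedBall).antisymm
  rw [ae_le_set, Metric.closedBall_diff_ball]
  exact Measure.addHaar_sphere_of_ne_zero _ _ hr.ne'

lemma gh_memLp_low {α : Type*} [MeasurableSpace α] {μ : Measure α} [IsFiniteMeasure μ] {h : α → ℝ}
    (h0 : ∀ x, 0 ≤ h x) {p q : ℝ} (hp : 0 < p) (hpq : p ≤ q)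
    (hi : Integrable (fun x => h x ^ q) μ) :
    Integrable (fun x => h x ^ p) μ := by
  have hq : 0 < q := hp.trans_le hpq
  have hm : AEStronglyMeasurable (fun x => h x ^ p) μ := by
    have h1 : AEMeasurable (fun x => (h x ^ q) ^ (p / q)) μ := hi.aemeasurable.pow_const _
    have h2 : (fun x => (h x ^ q) ^ (p / q)) = fun x => h x ^ p := by
      ext x
      rw [← Real.rpow_mul (h0 x)]
      congr 1
      field_simp
    rw [h2] at h1
    exact h1.aestronglyMeasurable
  refine Integrable.mono' ((integrable_const (1:ℝ)).add hi) hm (Filter.Eventually.of_forall fun x => ?_)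
  simp only [Pi.add_apply]
  rw [Real.norm_of_nonneg (Real.rpow_nonneg (h0 x) _)]
  rcases le_total (h x) 1 with hx | hx
  · have := Real.rpow_le_one (h0 x) hx hp.le
    have := Real.rpow_nonneg (h0 x) q
    linarith
  · have := Real.rpow_le_rpow_of_exponent_le hx hpq
    linarith

theorem stmt_16 {N : ℕ} (c d δ₀ : ℝ) (hc : 1 ≤ c) (hd : d ∈ Set.Ioo (0:ℝ) 1)
    (hδ₀ : 0 < δ₀) :
    ∃ δ c' : ℝ, 0 < δ ∧ δ ≤ δ₀ ∧ 1 ≤ c' ∧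
      ∀ (x₀ : EuclideanSpace ℝ (Fin N)) (R : ℝ)
        (g U : EuclideanSpace ℝ (Fin N) → ℝ),
        0 < R →
        (∀ x, 0 ≤ g x) → (∀ x, 0 ≤ U x) →
        IntegrableOn g (Metric.ball x₀ R) →
        IntegrableOn (fun x => U x ^ (1 + δ₀)) (Metric.ball x₀ R) →
        (∀ (y : EuclideanSpace ℝ (Fin N)) (ρ : ℝ), 0 < ρ →
          Metric.ball y (2 * ρ) ⊆ Metric.ball x₀ R →
          ⨍ x in Metric.ball y ρ, g x ≤
            c * (⨍ x in Metric.ball y (2 * ρ), g x ^ d) ^ (1 / d) +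
              c * ⨍ x in Metric.ball y (2 * ρ), U x) →
        ∀ (y : EuclideanSpace ℝ (Fin N)) (ρ : ℝ), 0 < ρ →
          Metric.ball y (2 * ρ) ⊆ Metric.ball x₀ R →
          IntegrableOn (fun x => g x ^ (1 + δ)) (Metric.ball y ρ) ∧
          (⨍ x in Metric.ball y ρ, g x ^ (1 + δ)) ^ (1 / (1 + δ)) ≤
            c' * ⨍ x in Metric.ball y (2 * ρ), g x +
              c' * (⨍ x in Metric.ball y (2 * ρ), U x ^ (1 + δ)) ^ (1 / (1 + δ)) := by
  obtain ⟨hd0, hd1⟩ := hd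
  set cE : ℝ≥0∞ := ENNReal.ofReal c with hcE
  have hcE1 : 1 ≤ cE := ENNReal.one_le_ofReal.2 hc
  have hcEt : cE ≠ ∞ := ENNReal.ofReal_ne_top
  set C4 : ℝ≥0∞ := 4 * (cE * 3 ^ N) with hC4
  have hC4t : C4 ≠ ∞ := ENNReal.mul_ne_top (by norm_num)
    (ENNReal.mul_ne_top hcEt (ENNReal.pow_ne_top (by norm_num)))
  have hC41 : 1 ≤ C4 := by
    calc (1:ℝ≥0∞) = 1 * (1 * 1) := by simp
      _ ≤ _ := mul_le_mul' (by norm_num) (mul_le_mul' hcE1 (one_le_pow₀ (by norm_num)))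
  have hC40 : C4 ≠ 0 := (zero_lt_one.trans_le hC41).ne'
  set e : ℝ≥0∞ := (C4⁻¹) ^ (1 / d) with he
  have he1 : e ≤ 1 := ENNReal.rpow_le_one (ENNReal.inv_le_one.2 hC41) (by positivity)
  have he0 : e ≠ 0 := by
    rw [he]
    exact (ENNReal.rpow_pos (ENNReal.inv_pos.2 hC4t) (ENNReal.inv_ne_top.2 hC40)).ne'
  have hed : e ^ d * C4 ≤ 1 := by
    rw [he, ← ENNReal.rpow_mul, one_div_mul_cancel hd0.ne', ENNReal.rpow_one,
      ENNReal.inv_mul_cancel hC40 hC4t]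
  have hei : e⁻¹ ≠ ∞ := ENNReal.inv_ne_top.2 he0
  set Z : ℝ≥0∞ := 5 ^ N * C4 * ENNReal.ofReal (1 / (1 - d)) * (e⁻¹) ^ (2:ℝ) * 2 with hZ
  have hZt : Z ≠ ∞ := by
    refine ENNReal.mul_ne_top (ENNReal.mul_ne_top (ENNReal.mul_ne_top (ENNReal.mul_ne_top
      (ENNReal.pow_ne_top (by norm_num)) hC4t) ENNReal.ofReal_ne_top)
      (ENNReal.rpow_ne_top_of_nonneg (by norm_num) hei)) (by norm_num)
  set δ : ℝ := min δ₀ (min 1 (1 / (Z.toReal + 1))) with hδdef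
  have hZp : 0 < Z.toReal + 1 := by positivity
  have hδ : 0 < δ := by positivity
  have hδδ : δ ≤ δ₀ := min_le_left _ _
  have hδ1 : δ ≤ 1 := (min_le_right _ _).trans (min_le_left _ _)
  have hδZ : δ ≤ 1 / (Z.toReal + 1) := (min_le_right _ _).trans (min_le_right _ _)
  have hsm : (5 ^ N * C4) * ENNReal.ofReal δ * ENNReal.ofReal (1 / (1 - d)) *
      (e⁻¹) ^ (2:ℝ) * 2 ≤ 1 := by
    calc _ = ENNReal.ofReal δ * Z := by rw [hZ]; ring
      _ = ENNReal.ofReal (δ * Z.toReal) := by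
        rw [ENNReal.ofReal_mul hδ.le, ENNReal.ofReal_toReal hZt]
      _ ≤ 1 := by
        rw [ENNReal.ofReal_le_one]
        rw [le_div_iff₀ hZp] at hδZ
        linarith
  set K : ℝ≥0∞ := 2 * 4 ^ N * (30 ^ N + 5 ^ N * C4 * e⁻¹) with hK
  have hKt : K ≠ ∞ := by
    refine ENNReal.mul_ne_top (ENNReal.mul_ne_top (by norm_num) (ENNReal.pow_ne_top (by norm_num)))
      (ENNReal.add_ne_top.2 ⟨ENNReal.pow_ne_top (by norm_num), ENNReal.mul_ne_top
        (ENNReal.mul_ne_top (ENNReal.pow_ne_top (by norm_num)) hC4t) hei⟩)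
  set K' : ℝ := K.toReal * 2 ^ N + 1 with hK'
  have hK'1 : 1 ≤ K' := by rw [hK']; linarith [show 0 ≤ K.toReal * 2 ^ N by positivity]
  refine ⟨δ, K', hδ, hδδ, hK'1, ?_⟩
  intro x₀ R₀ g U hR₀ hg hU hgi hUi hRH y ρ hρ hsub
  set B := Metric.ball y (2 * ρ) with hB
  have h2ρ : 0 < 2 * ρ := by linarith
  have hBm : MeasurableSet B := measurableSet_ball
  have hfinB : IsFiniteMeasure (volume.restrict B) :=
    ⟨by rw [Measure.restrict_apply_univ]; exact measure_ball_lt_top⟩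
  have hgB : IntegrableOn g B := hgi.mono_set hsub
  have hUB0 : IntegrableOn (fun x => U x ^ (1 + δ₀)) B := hUi.mono_set hsub
  have hUB1 : IntegrableOn (fun x => U x ^ (1 + δ)) B :=
    gh_memLp_low hU (by linarith) (by linarith) hUB0
  have hUB : IntegrableOn U B := by
    have := gh_memLp_low hU (p := 1) (by linarith) (by linarith) hUB0
    simp only [Real.rpow_one] at this
    exact this
  have hgd : IntegrableOn (fun x => g x ^ d) B := by
    apply gh_memLp_low hg hd0 hd1.le
    simp only [Real.rpow_one]
    exact hgB
  obtain ⟨g', hg'm, hg'⟩ := hgB.aemeasurable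
  obtain ⟨U', hU'm, hU'⟩ := hUB.aemeasurable
  set f : EuclideanSpace ℝ (Fin N) → ℝ≥0∞ := B.indicator fun x => ENNReal.ofReal (g' x) with hf
  set u : EuclideanSpace ℝ (Fin N) → ℝ≥0∞ := fun x => ENNReal.ofReal (U' x) with hu
  have hfm : Measurable f := hg'm.ennreal_ofReal.indicator hBm
  have hum : Measurable u := hU'm.ennreal_ofReal
  have hff : ∀ x, f x ≠ ∞ := by
    intro x
    simp only [hf, Set.indicator]
    split_ifs <;> simp
  have huf : ∀ x, u x ≠ ∞ := fun x => ENNReal.ofReal_ne_top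
  have hfg : ∀ᵐ x ∂(volume.restrict B), ENNReal.ofReal (g x) = f x := by
    filter_upwards [hg', ae_restrict_mem hBm] with x hx hxB
    simp [hf, hxB, hx]
  have huU : ∀ᵐ x ∂(volume.restrict B), ENNReal.ofReal (U x) = u x := by
    filter_upwards [hU'] with x hx
    simp [hu, hx]
  have hIf : ∫⁻ x, f x ≠ ∞ := by
    rw [hf, lintegral_indicator hBm]
    have e1 : ∫⁻ x in B, ENNReal.ofReal (g' x) = ∫⁻ x in B, ENNReal.ofReal (g x) := by
      apply lintegral_congr_ae
      filter_upwards [hg'] with x hx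
      rw [hx]
    rw [e1]
    exact (hgB.lintegral_lt_top).ne
  have avf : ∀ (s : Set (EuclideanSpace ℝ (Fin N))) (p : ℝ), 0 < p → s ⊆ B →
      IntegrableOn (fun x => g x ^ p) s →
      ENNReal.ofReal (⨍ x in s, g x ^ p) = (∫⁻ x in s, f x ^ p) / volume s := by
    intro s p hp hs hi
    rw [ofReal_setAverage hi (Filter.Eventually.of_forall fun x => Real.rpow_nonneg (hg x) _)]
    congr 1
    apply lintegral_congr_ae
    filter_upwards [ae_restrict_of_ae_restrict_of_subset hs hfg] with x hx
    rw [← hx, ENNReal.ofReal_rpow_of_nonneg (hg x) hp.le]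
  have avu : ∀ (s : Set (EuclideanSpace ℝ (Fin N))) (p : ℝ), 0 < p → s ⊆ B →
      IntegrableOn (fun x => U x ^ p) s →
      ENNReal.ofReal (⨍ x in s, U x ^ p) = (∫⁻ x in s, u x ^ p) / volume s := by
    intro s p hp hs hi
    rw [ofReal_setAverage hi (Filter.Eventually.of_forall fun x => Real.rpow_nonneg (hU x) _)]
    congr 1
    apply lintegral_congr_ae
    filter_upwards [ae_restrict_of_ae_restrict_of_subset hs huU] with x hx
    rw [← hx, ENNReal.ofReal_rpow_of_nonneg (hU x) hp.le]
  have avf1 : ∀ (s : Set (EuclideanSpace ℝ (Fin N))), s ⊆ B →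
      ENNReal.ofReal (⨍ x in s, g x) = (∫⁻ x in s, f x) / volume s := by
    intro s hs
    have := avf s 1 one_pos hs (by simpa only [Real.rpow_one] using hgB.mono_set hs)
    simpa only [Real.rpow_one, ENNReal.rpow_one] using this
  have avu1 : ∀ (s : Set (EuclideanSpace ℝ (Fin N))), s ⊆ B →
      ENNReal.ofReal (⨍ x in s, U x) = (∫⁻ x in s, u x) / volume s := by
    intro s hs
    have := avu s 1 one_pos hs (by simpa only [Real.rpow_one] using hUB.mono_set hs)
    simpa only [Real.rpow_one, ENNReal.rpow_one] using this
  have nng : ∀ (s : Set (EuclideanSpace ℝ (Fin N))) (h : EuclideanSpace ℝ (Fin N) → ℝ),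
      (∀ x, 0 ≤ h x) → 0 ≤ ⨍ x in s, h x := by
    intro s h hh
    rw [setAverage_eq]
    exact smul_nonneg (by positivity) (integral_nonneg hh)
  have H : ∀ x r, 0 < r → Metric.closedBall x (2 * r) ⊆ B →
      ∫⁻ z in Metric.closedBall x r, f z ≤ volume (Metric.closedBall x r) *
        (cE * (((∫⁻ z in Metric.closedBall x (2 * r), f z ^ d) /
          volume (Metric.closedBall x (2 * r))) ^ (1 / d) +
          (∫⁻ z in Metric.closedBall x (2 * r), u z) / volume (Metric.closedBall x (2 * r)))) := by
    intro x r hr hs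
    have hr2 : 0 < 2 * r := by linarith
    have hs2 : Metric.ball x (2 * r) ⊆ B := Metric.ball_subset_closedBall.trans hs
    have hs1 : Metric.ball x r ⊆ B := (Metric.ball_subset_ball (by linarith)).trans hs2
    have h1 := ENNReal.ofReal_le_ofReal (hRH x r hr (hs2.trans hsub))
    have n1 := nng (Metric.ball x (2 * r)) (fun x => g x ^ d) (fun x => Real.rpow_nonneg (hg x) _)
    have n2 := nng (Metric.ball x (2 * r)) U hU
    rw [ENNReal.ofReal_add (by positivity) (by positivity), ENNReal.ofReal_mul (by linarith),
      ENNReal.ofReal_mul (by linarith), ← ENNReal.ofReal_rpow_of_nonneg n1 (by positivity),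
      avf1 _ hs1, avu1 _ hs2, avf _ d hd0 hs2 (hgd.mono_set hs2), ← mul_add] at h1
    rw [setLIntegral_congr (gh_ball_ae x hr), setLIntegral_congr (gh_ball_ae x hr2),
      setLIntegral_congr (gh_ball_ae x hr2), measure_congr (gh_ball_ae x hr),
      measure_congr (gh_ball_ae x hr2)] at h1
    rw [ENNReal.div_le_iff (Metric.measure_closedBall_pos volume x hr).ne'
      measure_closedBall_lt_top.ne] at h1
    rw [mul_comm]
    exact h1
  have core := gh_core y h2ρ hfm hum hff huf hIf hd0 hd1 hδ hδ1 hcE1 he0 he1 hed hsm H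
  rw [show 2 * ρ / 2 = ρ by ring] at core
  have hsρ : Metric.ball y ρ ⊆ B := Metric.ball_subset_ball (by linarith)
  have hvB0 : volume B ≠ 0 := (Metric.measure_ball_pos volume y h2ρ).ne'
  have hvBt : volume B ≠ ∞ := measure_ball_lt_top.ne
  have hvρ0 : volume (Metric.ball y ρ) ≠ 0 := (Metric.measure_ball_pos volume y hρ).ne'
  have hvρt : volume (Metric.ball y ρ) ≠ ∞ := measure_ball_lt_top.ne
  have hvv : volume B = 2 ^ N * volume (Metric.ball y ρ) := by
    rw [hB, Measure.addHaar_ball_of_pos _ _ h2ρ, Measure.addHaar_ball_of_pos _ _ hρ, ← mul_assoc]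
    congr 1
    rw [finrank_euclideanSpace_fin, mul_pow, ENNReal.ofReal_mul (by positivity),
      ENNReal.ofReal_pow (by norm_num)]
    norm_num
  set ga := ⨍ x in B, g x with hga
  set Ub := ⨍ x in B, U x ^ (1 + δ) with hUb
  have hga0 : 0 ≤ ga := nng _ _ hg
  have hUb0 : 0 ≤ Ub := nng _ _ fun x => Real.rpow_nonneg (hU x) _
  have hδp : 0 < 1 + δ := by linarith
  have eB : ((∫⁻ x in B, f x) / volume B) ^ δ * (∫⁻ x in B, f x) + ∫⁻ x in B, u x ^ (1 + δ) =
      volume B * ENNReal.ofReal (ga ^ (1 + δ) + Ub) := by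
    have h1 : ∫⁻ x in B, f x = volume B * ENNReal.ofReal ga := by
      rw [hga, avf1 B subset_rfl, ENNReal.mul_div_cancel hvB0 hvBt]
    have h2 : ∫⁻ x in B, u x ^ (1 + δ) = volume B * ENNReal.ofReal Ub := by
      rw [hUb, avu B _ hδp subset_rfl hUB1, ENNReal.mul_div_cancel hvB0 hvBt]
    rw [← avf1 B subset_rfl, ← hga, h1, h2, ENNReal.ofReal_add (by positivity) hUb0,
      ← ENNReal.ofReal_rpow_of_nonneg hga0 hδp.le,
      ENNReal.rpow_add_of_nonneg _ _ zero_le_one hδ.le, ENNReal.rpow_one]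
    ring
  rw [eB] at core
  have hfin : ∫⁻ x in Metric.ball y ρ, f x ^ (1 + δ) ≠ ∞ :=
    ne_top_of_le_ne_top (ENNReal.mul_ne_top hKt (ENNReal.mul_ne_top hvBt ENNReal.ofReal_ne_top)) core
  have hgInt : IntegrableOn (fun x => g x ^ (1 + δ)) (Metric.ball y ρ) := by
    refine ⟨((hgB.mono_set hsρ).aemeasurable.pow_const _).aestronglyMeasurable, ?_⟩
    rw [hasFiniteIntegral_iff_ofReal
      (Filter.Eventually.of_forall fun x => Real.rpow_nonneg (hg x) _)]
    rw [lt_top_iff_ne_top]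
    convert hfin using 1
    apply lintegral_congr_ae
    filter_upwards [ae_restrict_of_ae_restrict_of_subset hsρ hfg] with x hx
    rw [← hx, ENNReal.ofReal_rpow_of_nonneg (hg x) hδp.le]
  refine ⟨hgInt, ?_⟩
  set m := ⨍ x in Metric.ball y ρ, g x ^ (1 + δ) with hm
  have hm0 : 0 ≤ m := nng _ _ fun x => Real.rpow_nonneg (hg x) _
  set Q := ga ^ (1 + δ) + Ub with hQ
  have hQ0 : 0 ≤ Q := by positivity
  have hmQ : m ≤ K' * Q := by
    have h1 : ENNReal.ofReal m ≤ ENNReal.ofReal (K.toReal * 2 ^ N * Q) := by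
      rw [hm, avf _ _ hδp hsρ hgInt, ENNReal.div_le_iff hvρ0 hvρt]
      refine core.trans (le_of_eq ?_)
      rw [hvv, ENNReal.ofReal_mul (by positivity), ENNReal.ofReal_mul (by positivity),
        ENNReal.ofReal_toReal hKt, ENNReal.ofReal_pow (by norm_num),
        show ENNReal.ofReal 2 = 2 by norm_num]
      ring
    rw [ENNReal.ofReal_le_ofReal_iff (by positivity)] at h1
    rw [hK']
    nlinarith
  have hp0 : 0 ≤ 1 / (1 + δ) := by positivity
  have hp1 : 1 / (1 + δ) ≤ 1 := by rw [div_le_one hδp]; linarith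
  calc m ^ (1 / (1 + δ)) ≤ (K' * Q) ^ (1 / (1 + δ)) := Real.rpow_le_rpow hm0 hmQ hp0
    _ = K' ^ (1 / (1 + δ)) * Q ^ (1 / (1 + δ)) := Real.mul_rpow (by linarith) hQ0
    _ ≤ K' * (ga + Ub ^ (1 / (1 + δ))) := by
      apply mul_le_mul _ _ (by positivity) (by linarith)
      · calc K' ^ (1 / (1 + δ)) ≤ K' ^ (1:ℝ) := Real.rpow_le_rpow_of_exponent_le hK'1 hp1
          _ = K' := Real.rpow_one _
      · calc Q ^ (1 / (1 + δ)) ≤ (ga ^ (1 + δ)) ^ (1 / (1 + δ)) + Ub ^ (1 / (1 + δ)) :=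
              Real.rpow_add_le_add_rpow (by positivity) hUb0 hp0 hp1
          _ = _ := by
            rw [← Real.rpow_mul hga0, mul_one_div_cancel hδp.ne', Real.rpow_one]
    _ ≤ K' * (ga + K' * Ub ^ (1 / (1 + δ))) := by
      have hw : 0 ≤ Ub ^ (1 / (1 + δ)) := Real.rpow_nonneg hUb0 _
      gcongr
      exact le_mul_of_one_le_left hw hK'1
    _ = _ := by
      congr 1
      have hne : NeZero (volume.restrict B) :=
        ⟨by rw [Ne, Measure.restrict_eq_zero]; exact hvB0⟩
      rw [average_eq, integral_add hgB (integrable_const _), smul_add, ← average_eq, ← average_eq,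
        average_const]
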